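/- Let E = {… < x_{−1} < x_0 < x_1 < …} ⊆ ℤ be unbounded above and below, enumerated increasingly, and let F ⊆ ℤ. Define E ∗ F = {x_n : n ∈ F}. Then D(E ∗ F) ≤ D(E)·D(F). -/

import Mathlib

open Filter MeasureTheory
open scoped ENNReal

noncomputable section

/-- The filter of intervals `(M, N]` of `ℤ` as the length `N - M` tends to infinity.
An interval is encoded by the pair `(M, N)`. -/
def intervalFilter : Filter (ℤ × ℤ) :=
  Filter.comap (fun p : ℤ × ℤ => p.2 - p.1) Filter.atTop

/-- The number of elements of `E` in the interval `(M, N]`. -/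
def icount (E : Set ℤ) (M N : ℤ) : ℕ := (E ∩ Set.Ioc M N).ncard

/-- The counting dimension of `E ⊆ ℤ`:
`D(E) = limsup_{|I| → ∞} log |E ∩ I| / log |I|`. -/
def countingDim (E : Set ℤ) : ℝ :=
  Filter.limsup
    (fun p : ℤ × ℤ => Real.log (icount E p.1 p.2) / Real.log ((p.2 - p.1 : ℤ) : ℝ))
    intervalFilter

/-- The counting `α`-measure of `E ⊆ ℤ`:
`H_α(E) = limsup_{|I| → ∞} |E ∩ I| / |I|^α`, with values in `[0, ∞]`. -/
def countingMeasure (α : ℝ) (E : Set ℤ) : ℝ≥0∞ :=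
  Filter.limsup
    (fun p : ℤ × ℤ =>
      ENNReal.ofReal ((icount E p.1 p.2 : ℝ) / ((p.2 - p.1 : ℤ) : ℝ) ^ α))
    intervalFilter

/-- The upper-Banach density of `E ⊆ ℤ`:
`d*(E) = limsup_{|I| → ∞} |E ∩ I| / |I|`. -/
def upperBanach (E : Set ℤ) : ℝ :=
  Filter.limsup
    (fun p : ℤ × ℤ => (icount E p.1 p.2 : ℝ) / ((p.2 - p.1 : ℤ) : ℝ))
    intervalFilter

/-- `E ⊆ ℤ` is regular if `0 < H_{D(E)}(E) < ∞`. -/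
def Regular (E : Set ℤ) : Prop :=
  0 < countingMeasure (countingDim E) E ∧ countingMeasure (countingDim E) E < ⊤

/-- Two (regular) sets `E, F ⊆ ℤ` are compatible if there are sequences of intervals
`I_n = (a n, b n]`, `J_n = (c n, d n]` with increasing lengths, `|I_n| ≍ |J_n|`,
`|E ∩ I_n| ≫ |I_n|^{D(E)}` and `|F ∩ J_n| ≫ |J_n|^{D(F)}`. -/
def Compatible (E F : Set ℤ) : Prop :=
  ∃ a b c d : ℕ → ℤ,
    (∀ n, a n < b n) ∧ (∀ n, c n < d n) ∧
    StrictMono (fun n => b n - a n) ∧ StrictMono (fun n => d n - c n) ∧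
    (∃ C : ℝ, 0 < C ∧ ∀ n,
      ((b n - a n : ℤ) : ℝ) ≤ C * ((d n - c n : ℤ) : ℝ) ∧
      ((d n - c n : ℤ) : ℝ) ≤ C * ((b n - a n : ℤ) : ℝ)) ∧
    (∃ c₁ : ℝ, 0 < c₁ ∧ ∀ n,
      c₁ * ((b n - a n : ℤ) : ℝ) ^ countingDim E ≤ (icount E (a n) (b n) : ℝ)) ∧
    (∃ c₂ : ℝ, 0 < c₂ ∧ ∀ n,
      c₂ * ((d n - c n : ℤ) : ℝ) ^ countingDim F ≤ (icount F (c n) (d n) : ℝ))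

/-- The arithmetic sum `E + ⌊λ F⌋ = {a + ⌊λ b⌋ : a ∈ E, b ∈ F}`. -/
def sumFloor (E F : Set ℤ) (l : ℝ) : Set ℤ :=
  {n : ℤ | ∃ a ∈ E, ∃ b ∈ F, n = a + ⌊l * (b : ℝ)⌋}

instance intervalFilter_neBot : intervalFilter.NeBot := by
  refine Filter.NeBot.comap_of_surj inferInstance fun k => ⟨(0, k), by simp⟩

theorem eventually_intervalFilter_iff {P : ℤ × ℤ → Prop} :
    (∀ᶠ p in intervalFilter, P p) ↔ ∃ K : ℤ, ∀ M N : ℤ, K ≤ N - M → P (M, N) := by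
  rw [intervalFilter, Filter.eventually_comap, Filter.eventually_atTop]
  constructor
  · rintro ⟨K, hK⟩
    exact ⟨K, fun M N h => hK _ h _ rfl⟩
  · rintro ⟨K, hK⟩
    refine ⟨K, ?_⟩
    rintro b hb ⟨M, N⟩ rfl
    exact hK M N hb

theorem tendsto_length_intervalFilter :
    Tendsto (fun p : ℤ × ℤ => ((p.2 - p.1 : ℤ) : ℝ)) intervalFilter atTop :=
  tendsto_intCast_atTop_atTop.comp tendsto_comap

theorem icount_le (E : Set ℤ) (M N : ℤ) : icount E M N ≤ (N - M).toNat := by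
  refine (Set.ncard_le_ncard Set.inter_subset_right (Set.finite_Ioc M N)).trans ?_
  rw [← Finset.coe_Ioc, Set.ncard_coe_finset, Int.card_Ioc]

theorem log_icount_nonneg (E : Set ℤ) (M N : ℤ) : 0 ≤ Real.log (icount E M N) :=
  Real.log_natCast_nonneg _

theorem log_icount_le (E : Set ℤ) {M N : ℤ} (h : 1 ≤ N - M) :
    Real.log (icount E M N) ≤ Real.log ((N - M : ℤ) : ℝ) := by
  have h1 : (1 : ℝ) ≤ ((N - M : ℤ) : ℝ) := by exact_mod_cast h
  rcases Nat.eq_zero_or_pos (icount E M N) with h0 | h0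
  · rw [h0]
    simpa using Real.log_nonneg h1
  · refine Real.log_le_log (by exact_mod_cast h0) ?_
    have := icount_le E M N
    have h2 : (icount E M N : ℤ) ≤ N - M := by omega
    exact_mod_cast h2

theorem eventually_logRatio_nonneg (E : Set ℤ) : ∀ᶠ p : ℤ × ℤ in intervalFilter,
    0 ≤ Real.log (icount E p.1 p.2) / Real.log ((p.2 - p.1 : ℤ) : ℝ) := by
  filter_upwards [tendsto_length_intervalFilter.eventually_ge_atTop 1] with p hp
  exact div_nonneg (log_icount_nonneg ..) (Real.log_nonneg hp)

theorem eventually_logRatio_le_one (E : Set ℤ) : ∀ᶠ p : ℤ × ℤ in intervalFilter,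
    Real.log (icount E p.1 p.2) / Real.log ((p.2 - p.1 : ℤ) : ℝ) ≤ 1 := by
  filter_upwards [tendsto_length_intervalFilter.eventually_ge_atTop 1] with p hp
  exact div_le_one_of_le₀ (log_icount_le E (by exact_mod_cast hp)) (Real.log_nonneg hp)

theorem isBoundedUnder_logRatio (E : Set ℤ) : intervalFilter.IsBoundedUnder (· ≤ ·)
    (fun p : ℤ × ℤ => Real.log (icount E p.1 p.2) / Real.log ((p.2 - p.1 : ℤ) : ℝ)) :=
  ⟨1, eventually_map.2 (eventually_logRatio_le_one E)⟩

theorem isCoboundedUnder_logRatio (E : Set ℤ) : intervalFilter.IsCoboundedUnder (· ≤ ·)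
    (fun p : ℤ × ℤ => Real.log (icount E p.1 p.2) / Real.log ((p.2 - p.1 : ℤ) : ℝ)) :=
  Filter.IsBoundedUnder.isCoboundedUnder_le ⟨0, eventually_map.2 (eventually_logRatio_nonneg E)⟩

theorem countingDim_nonneg (E : Set ℤ) : 0 ≤ countingDim E :=
  Filter.le_limsup_of_frequently_le (eventually_logRatio_nonneg E).frequently
    (isBoundedUnder_logRatio E)

theorem countingDim_le_of_eventually {E : Set ℤ} {c : ℝ} (h : ∀ᶠ p : ℤ × ℤ in intervalFilter,
    Real.log (icount E p.1 p.2) ≤ c * Real.log ((p.2 - p.1 : ℤ) : ℝ)) : countingDim E ≤ c := by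
  refine Filter.limsup_le_of_le (isCoboundedUnder_logRatio E) ?_
  filter_upwards [h, tendsto_length_intervalFilter.eventually_gt_atTop 1] with p hp h1
  exact (div_le_iff₀ (Real.log_pos h1)).2 hp

theorem eventually_log_icount_le {E : Set ℤ} {c : ℝ} (h : countingDim E < c) :
    ∀ᶠ p : ℤ × ℤ in intervalFilter,
      Real.log (icount E p.1 p.2) ≤ c * Real.log ((p.2 - p.1 : ℤ) : ℝ) := by
  filter_upwards [Filter.eventually_lt_of_limsup_lt h (isBoundedUnder_logRatio E),
    tendsto_length_intervalFilter.eventually_gt_atTop 1] with p hp h1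
  exact ((div_lt_iff₀ (Real.log_pos h1)).1 hp).le

/-- A strictly increasing map `ℤ → ℤ` has an upper adjoint. -/
theorem StrictMono.exists_forall_int_le_iff {x : ℤ → ℤ} (hx : StrictMono x) (M : ℤ) :
    ∃ m, ∀ i, x i ≤ M ↔ i ≤ m := by
  have hmono : Monotone fun i => x i - i := monotone_int_of_le_succ fun i => by
    have := hx (Int.lt_add_one_iff.2 le_rfl : i < i + 1)
    omega
  obtain ⟨m, hm, hmax⟩ := Int.exists_greatest_of_bdd (P := fun i => x i ≤ M)
    ⟨max 0 (M - x 0), fun i hi => by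
      by_contra! h
      have := hmono (show 0 ≤ i by omega)
      simp only at this
      omega⟩
    ⟨min 0 (M - x 0), by
      have := hmono (show min 0 (M - x 0) ≤ 0 by omega)
      simp only at this
      omega⟩
  exact ⟨m, fun i => ⟨hmax i, fun hi => (hx.monotone hi).trans hm⟩⟩

theorem StrictMono.exists_icount_image_eq {x : ℤ → ℤ} (hx : StrictMono x) (M N : ℤ) :
    ∃ m n, ∀ F : Set ℤ, icount (x '' F) M N = icount F m n := by
  obtain ⟨m, hm⟩ := hx.exists_forall_int_le_iff M
  obtain ⟨n, hn⟩ := hx.exists_forall_int_le_iff N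
  refine ⟨m, n, fun F => ?_⟩
  have hpre : x ⁻¹' Set.Ioc M N = Set.Ioc m n := by
    ext i
    simp only [Set.mem_preimage, Set.mem_Ioc, hn, ← not_le, hm]
  rw [icount, icount, ← hpre, ← Set.image_inter_preimage,
    Set.ncard_image_of_injective _ hx.injective]

theorem icount_univ (M N : ℤ) : icount Set.univ M N = (N - M).toNat := by
  rw [icount, Set.univ_inter, ← Finset.coe_Ioc, Set.ncard_coe_finset, Int.card_Ioc]

theorem countingDim_image_le_mul {x : ℤ → ℤ} (hx : StrictMono x) (F : Set ℤ) {a b : ℝ}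
    (ha : countingDim (Set.range x) < a) (hb : countingDim F < b) :
    countingDim (x '' F) ≤ a * b := by
  have ha0 : 0 < a := (countingDim_nonneg _).trans_lt ha
  have hb0 : 0 < b := (countingDim_nonneg _).trans_lt hb
  obtain ⟨K, hK⟩ := eventually_intervalFilter_iff.1 (eventually_log_icount_le hb)
  have hlarge := (Real.tendsto_log_atTop.comp
    tendsto_length_intervalFilter).eventually_ge_atTop (Real.log (K.toNat : ℝ) / (a * b))
  apply countingDim_le_of_eventually
  filter_upwards [eventually_log_icount_le ha, hlarge,
    tendsto_length_intervalFilter.eventually_ge_atTop 1] with p hE hL h1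
  have hL0 := Real.log_nonneg h1
  obtain ⟨m, n, hmn⟩ := hx.exists_icount_image_eq p.1 p.2
  rw [← Set.image_univ, hmn, icount_univ] at hE
  rw [hmn]
  rcases Nat.eq_zero_or_pos (icount F m n) with h0 | h0
  · rw [h0]
    simpa using mul_nonneg (mul_pos ha0 hb0).le hL0
  have hle := icount_le F m n
  by_cases hk : K ≤ n - m
  · have hF := hK m n hk
    have hcast : (((n - m).toNat : ℕ) : ℝ) = ((n - m : ℤ) : ℝ) := by
      exact_mod_cast Int.toNat_of_nonneg (show 0 ≤ n - m by omega)
    rw [hcast] at hE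
    calc Real.log (icount F m n) ≤ b * Real.log ((n - m : ℤ) : ℝ) := hF
      _ ≤ b * (a * Real.log ((p.2 - p.1 : ℤ) : ℝ)) := by gcongr
      _ = a * b * Real.log ((p.2 - p.1 : ℤ) : ℝ) := by ring
  · calc Real.log (icount F m n) ≤ Real.log (K.toNat : ℝ) :=
          Real.log_le_log (by exact_mod_cast h0) (by exact_mod_cast (by omega))
      _ ≤ a * b * Real.log ((p.2 - p.1 : ℤ) : ℝ) := (div_le_iff₀' (mul_pos ha0 hb0)).1 hL

/-- If `E = {⋯ < x_{-1} < x_0 < x_1 < ⋯} ⊆ ℤ` is enumerated increasingly by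
`x : ℤ → ℤ` and `F ⊆ ℤ`, then `E ∗ F = {x_n : n ∈ F}` satisfies
`D(E ∗ F) ≤ D(E) · D(F)`. -/
theorem star_dimension (x : ℤ → ℤ) (hx : StrictMono x) (F : Set ℤ) :
    countingDim (x '' F) ≤ countingDim (Set.range x) * countingDim F := by
  have hlim : Tendsto (fun ε : ℝ => (countingDim (Set.range x) + ε) * (countingDim F + ε))
      (nhdsWithin 0 (Set.Ioi 0)) (nhds (countingDim (Set.range x) * countingDim F)) := by
    have hcont : Continuous fun ε : ℝ => (countingDim (Set.range x) + ε) * (countingDim F + ε) := by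
      fun_prop
    simpa using (hcont.tendsto 0).mono_left nhdsWithin_le_nhds
  refine ge_of_tendsto hlim ?_
  filter_upwards [self_mem_nhdsWithin] with ε hε
  have hε0 : 0 < ε := hε
  exact countingDim_image_le_mul hx F (by linarith) (by linarith)
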